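/- Let R be a commutative ring and n ≥ 3. Then the matrix ring Mₙ(R) is a GWNC ring if and only if Mₙ(R) is a nil-clean ring. -/

import Mathlib

def IsWeaklyNilCleanElem {R : Type*} [Ring R] (a : R) : Prop :=
  ∃ e q : R, IsIdempotentElem e ∧ IsNilpotent q ∧ (a = q + e ∨ a = q - e)

def IsGWNCRing (R : Type*) [Ring R] : Prop :=
  ∀ a : R, ¬IsUnit a → IsWeaklyNilCleanElem a

def IsNilCleanRing (R : Type*) [Ring R] : Prop :=
  ∀ a : R, ∃ e q : R, IsIdempotentElem e ∧ IsNilpotent q ∧ a = q + e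

open Module

/-- An element is nil-clean if it is the sum of a nilpotent and an idempotent. -/
def IsNilCleanElem {R : Type*} [Ring R] (a : R) : Prop :=
  ∃ e q : R, IsIdempotentElem e ∧ IsNilpotent q ∧ a = q + e

lemma IsNilCleanElem.map {R S F : Type*} [Ring R] [Ring S] [FunLike F R S] [RingHomClass F R S]
    (f : F) {a : R} (ha : IsNilCleanElem a) : IsNilCleanElem (f a) := by
  obtain ⟨e, q, he, hq, rfl⟩ := ha
  exact ⟨f e, f q, he.map f, hq.map f, map_add f q e⟩

/-- Nil-clean elements lift along surjections with nil kernel. -/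
lemma IsNilCleanElem.of_map {R S : Type*} [Ring R] [Ring S] (f : R →+* S)
    (hf : Function.Surjective f) (hker : ∀ x ∈ RingHom.ker f, IsNilpotent x) {a : R}
    (ha : IsNilCleanElem (f a)) : IsNilCleanElem a := by
  obtain ⟨e, q, he, ⟨k, hk⟩, h⟩ := ha
  obtain ⟨e', he', rfl⟩ := exists_isIdempotentElem_eq_of_ker_isNilpotent f hker e (hf e) he
  refine ⟨e', a - e', he', ?_, by simp⟩
  obtain ⟨l, hl⟩ := hker ((a - e') ^ k) (by
    rw [RingHom.mem_ker, map_pow, map_sub, h, add_sub_cancel_right, hk])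
  exact ⟨k * l, by rw [pow_mul, hl]⟩

/-- A square matrix with nilpotent entries is nilpotent. -/
lemma Matrix.isNilpotent_of_forall_isNilpotent {ι R : Type*} [Fintype ι] [DecidableEq ι]
    [CommRing R] {M : Matrix ι ι R} (hM : ∀ i j, IsNilpotent (M i j)) : IsNilpotent M := by
  set I : Ideal R := Ideal.span (Set.range fun p : ι × ι => M p.1 p.2) with hI
  have hfg : I.FG := Submodule.fg_span (Set.finite_range _)
  have hle : I ≤ nilradical R := by
    rw [hI, Ideal.span_le]
    rintro _ ⟨p, rfl⟩
    exact hM p.1 p.2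
  obtain ⟨k, hk⟩ := (Ideal.FG.isNilpotent_iff_le_nilradical hfg).2 hle
  have hpow : ∀ m i j, (M ^ m) i j ∈ I ^ m := by
    intro m
    induction m with
    | zero => simp
    | succ m ih =>
      intro i j
      rw [pow_succ M, Matrix.mul_apply, pow_succ I]
      exact sum_mem fun l _ =>
        Ideal.mul_mem_mul (ih i l) (Ideal.subset_span ⟨(l, j), rfl⟩)
  refine ⟨k, ?_⟩
  ext i j
  simpa [hk] using hpow k i j

/-- Nil-clean elements may be glued along a complete family of orthogonal idempotents. -/
lemma IsNilCleanElem.of_smul {ι B S : Type*} [Fintype ι] [CommRing B] [Ring S] [Algebra B S]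
    {χ : ι → B} (hχ : CompleteOrthogonalIdempotents χ) {a : S} {b : ι → S}
    (hb : ∀ i, IsNilCleanElem (b i)) (hab : ∀ i, χ i • a = χ i • b i) : IsNilCleanElem a := by
  classical
  choose e q he hq hbeq using hb
  choose k hk using hq
  have hmul : ∀ f g : ι → S,
      (∑ i, χ i • f i) * (∑ i, χ i • g i) = ∑ i, χ i • (f i * g i) := by
    intro f g
    rw [Finset.sum_mul_sum]
    refine Finset.sum_congr rfl fun i _ => ?_
    rw [Finset.sum_eq_single i]
    · rw [smul_mul_smul_comm, (hχ.idem i).eq]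
    · intro j _ hj
      rw [smul_mul_smul_comm, hχ.ortho hj.symm, zero_smul]
    · simp
  have hpow : ∀ (f : ι → S) (m : ℕ), (∑ i, χ i • f i) ^ m = ∑ i, χ i • f i ^ m := by
    intro f m
    induction m with
    | zero => simp [← Finset.sum_smul, hχ.complete]
    | succ m ih => simp only [pow_succ, ih, hmul]
  refine ⟨∑ i, χ i • e i, ∑ i, χ i • q i, ?_, ⟨∑ i, k i, ?_⟩, ?_⟩
  · rw [IsIdempotentElem, hmul]
    exact Finset.sum_congr rfl fun i _ => by rw [(he i).eq]
  · rw [hpow]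
    refine Finset.sum_eq_zero fun i hi => ?_
    rw [pow_eq_zero_of_le (Finset.single_le_sum (fun _ _ => Nat.zero_le _) hi) (hk i), smul_zero]
  · rw [← Finset.sum_add_distrib]
    calc a = ∑ i, χ i • a := by rw [← Finset.sum_smul, hχ.complete, one_smul]
      _ = _ := Finset.sum_congr rfl fun i _ => by rw [hab, hbeq, smul_add]

/-- Over a ring all of whose elements are idempotent, matrices are nil-clean as soon as matrices
over `ZMod 2` are. -/
lemma Matrix.isNilCleanElem_of_forall_isIdempotentElem {ι B : Type*} [Fintype ι] [DecidableEq ι]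
    [CommRing B] (hB : ∀ x : B, IsIdempotentElem x)
    (h₂ : ∀ M : Matrix ι ι (ZMod 2), IsNilCleanElem M) (A : Matrix ι ι B) :
    IsNilCleanElem A := by
  have two : ((2 : ℕ) : B) = 0 := by
    have := (hB 2).eq
    push_cast
    linear_combination this
  have htwo : (2 : B) = 0 := by exact_mod_cast two
  let f : ZMod 2 →+* B := ZMod.castHom (ringChar.dvd two) B
  let χ : (ι × ι → ZMod 2) → B := fun g => ∏ p, (1 + A p.1 p.2 + f (g p))
  have hχ : CompleteOrthogonalIdempotents χ := by
    rw [CompleteOrthogonalIdempotents.iff_ortho_complete]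
    constructor
    · intro g g' hg
      obtain ⟨p, hp⟩ := Function.ne_iff.1 hg
      simp only [χ]
      rw [← Finset.prod_mul_distrib]
      refine Finset.prod_eq_zero (Finset.mem_univ p) ?_
      have hsum : g' p = g p + 1 := by
        revert hp
        generalize g p = x
        generalize g' p = y
        revert x y
        decide
      rw [hsum, map_add, map_one]
      linear_combination (hB (A p.1 p.2 + f (g p))).eq +
        (1 + 2 * (A p.1 p.2 + f (g p))) * htwo
    · simp only [χ]
      rw [← Fintype.piFinset_univ, ← Finset.prod_univ_sum (fun _ => Finset.univ)
        fun (p : ι × ι) m => 1 + A p.1 p.2 + f m]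
      refine Finset.prod_eq_one fun p _ => ?_
      have : (Finset.univ : Finset (ZMod 2)) = {0, 1} := rfl
      rw [this, Finset.sum_pair (by decide), map_zero, map_one]
      linear_combination (1 + A p.1 p.2) * htwo
  refine IsNilCleanElem.of_smul hχ
    (b := fun g => f.mapMatrix (Matrix.of fun i j => g (i, j))) (fun g => (h₂ _).map _) ?_
  intro g
  ext i j
  simp only [Matrix.smul_apply, smul_eq_mul, RingHom.mapMatrix_apply, Matrix.map_apply,
    Matrix.of_apply, χ]
  rw [← sub_eq_zero, ← mul_sub, ← Finset.mul_prod_erase _ _ (Finset.mem_univ (i, j))]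
  linear_combination (∏ p ∈ Finset.univ.erase (i, j), (1 + A p.1 p.2 + f (g p))) *
    ((hB (A i j)).eq - (hB (f (g (i, j)))).eq + (A i j - f (g (i, j))) * htwo)

/-- If `x ^ 2 - x` is always nilpotent, matrices are nil-clean as soon as matrices over `ZMod 2`
are. -/
lemma Matrix.isNilCleanElem_of_forall_isNilpotent {ι R : Type*} [Fintype ι] [DecidableEq ι]
    [CommRing R] (hR : ∀ x : R, IsNilpotent (x ^ 2 - x))
    (h₂ : ∀ M : Matrix ι ι (ZMod 2), IsNilCleanElem M) (A : Matrix ι ι R) :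
    IsNilCleanElem A := by
  let f := Ideal.Quotient.mk (nilradical R)
  have hf : Function.Surjective f := Ideal.Quotient.mk_surjective
  refine IsNilCleanElem.of_map f.mapMatrix (fun M => ?_) (fun M hM => ?_)
    (Matrix.isNilCleanElem_of_forall_isIdempotentElem (fun x => ?_) h₂ _)
  · choose g hg using hf
    exact ⟨M.map g, by ext; simp [hg]⟩
  · refine Matrix.isNilpotent_of_forall_isNilpotent fun i j => ?_
    rw [RingHom.mem_ker] at hM
    have : f (M i j) = 0 := congrFun (congrFun hM i) j
    rwa [Ideal.Quotient.eq_zero_iff_mem] at this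
  · obtain ⟨x, rfl⟩ := hf x
    rw [IsIdempotentElem, ← map_mul, Ideal.Quotient.eq, ← pow_two]
    exact hR x

section Trace

open scoped Matrix

variable {ι K : Type*} [Fintype ι] [DecidableEq ι] [Field K]

lemma Matrix.trace_eq_rank_of_isIdempotentElem {e : Matrix ι ι K} (he : IsIdempotentElem e) :
    e.trace = e.rank := by
  have h := (LinearMap.IsIdempotentElem.isProj_range _
    (he.map (Matrix.toLinAlgEquiv' (R := K) (n := ι)))).trace
  rw [show Matrix.toLinAlgEquiv' e = Matrix.toLin' e from rfl, Matrix.trace_toLin'_eq] at h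
  exact h

lemma Matrix.trace_eq_rank_of_eq_add {a e q : Matrix ι ι K} (he : IsIdempotentElem e)
    (hq : IsNilpotent q) (h : a = q + e) : a.trace = e.rank := by
  rw [h, Matrix.trace_add, (Matrix.isNilpotent_trace_of_isNilpotent hq).eq_zero, zero_add,
    Matrix.trace_eq_rank_of_isIdempotentElem he]

/-- If `a` is the sum of a nilpotent and the idempotent `e`, then `rank e ≤ rank a`, because the
range of `e` meets the kernel of `a` trivially. -/
lemma Matrix.rank_le_rank_of_eq_add {a e q : Matrix ι ι K} (he : IsIdempotentElem e)
    (hq : IsNilpotent q) (h : a = q + e) : e.rank ≤ a.rank := by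
  have hdisj : Disjoint e.mulVecLin.range a.mulVecLin.ker := by
    rw [Submodule.disjoint_def]
    rintro _ ⟨w, rfl⟩ hw
    simp only [LinearMap.mem_ker, Matrix.mulVecLin_apply] at hw ⊢
    have hqe : q *ᵥ (e *ᵥ w) = -(e *ᵥ w) := by
      rw [h, Matrix.add_mulVec, Matrix.mulVec_mulVec w e e, he.eq] at hw
      exact eq_neg_of_add_eq_zero_left hw
    have hpow : ∀ k : ℕ, q ^ k *ᵥ (e *ᵥ w) = (-1 : K) ^ k • (e *ᵥ w) := by
      intro k
      induction k with
      | zero => simp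
      | succ k ih =>
        rw [pow_succ' q, ← Matrix.mulVec_mulVec, ih, Matrix.mulVec_smul, hqe, pow_succ]
        simp
    obtain ⟨k, hk⟩ := hq
    have := hpow k
    rw [hk, Matrix.zero_mulVec] at this
    exact (smul_eq_zero.1 this.symm).resolve_left (pow_ne_zero _ (by simp))
  have h₁ := Submodule.finrank_add_finrank_le_of_disjoint hdisj
  have h₂ := LinearMap.finrank_range_add_finrank_ker a.mulVecLin
  unfold Matrix.rank
  omega

/-- A non-nilpotent nil-clean matrix of rank at most two and trace zero exists only in
characteristic two. -/
lemma Matrix.two_eq_zero_of_isNilCleanElem {a : Matrix ι ι K} (ha : a.rank ≤ 2)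
    (htr : a.trace = 0) (hnil : ¬ IsNilpotent a) (h : IsNilCleanElem a) : (2 : K) = 0 := by
  obtain ⟨e, q, he, hq, h⟩ := h
  have h₁ := Matrix.trace_eq_rank_of_eq_add he hq h
  have h₂ := Matrix.rank_le_rank_of_eq_add he hq h
  have h₃ : e.rank ≠ 0 := by
    intro h0
    replace h0 : e = 0 := by
      have hbot : e.mulVecLin.range = ⊥ := Submodule.finrank_eq_zero.1 h0
      rw [LinearMap.range_eq_bot] at hbot
      exact Matrix.toLin'.map_eq_zero_iff.1 hbot
    exact hnil (by rwa [h, h0, add_zero])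
  rw [htr] at h₁
  obtain h | h : e.rank = 1 ∨ e.rank = 2 := by omega
  · simp [h] at h₁
  · simpa [h] using h₁.symm

end Trace

lemma IsWeaklyNilCleanElem.isNilCleanElem_or {R : Type*} [Ring R] {a : R}
    (ha : IsWeaklyNilCleanElem a) : IsNilCleanElem a ∨ IsNilCleanElem (-a) := by
  obtain ⟨e, q, he, hq, h | h⟩ := ha
  · exact .inl ⟨e, q, he, hq, h⟩
  · exact .inr ⟨e, -q, he, hq.neg, by rw [h]; abel⟩

lemma Matrix.not_isUnit_diagonal {ι R : Type*} [Fintype ι] [DecidableEq ι] [CommRing R]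
    [Nontrivial R] {w : ι → R} {i : ι} (hi : w i = 0) : ¬ IsUnit (Matrix.diagonal w) := by
  rw [Matrix.isUnit_iff_isUnit_det, Matrix.det_diagonal,
    Finset.prod_eq_zero (Finset.mem_univ i) hi]
  exact not_isUnit_zero

/-- Diagonal matrices with a zero entry are nil-clean up to sign after base change. -/
lemma IsGWNCRing.isNilCleanElem_diagonal_or {ι R K : Type*} [Fintype ι] [DecidableEq ι]
    [CommRing R] [Field K] (hR : IsGWNCRing (Matrix ι ι R)) (φ : R →+* K) {w : ι → R} {i : ι}
    (hi : w i = 0) :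
    IsNilCleanElem (Matrix.diagonal (φ ∘ w)) ∨ IsNilCleanElem (-Matrix.diagonal (φ ∘ w)) := by
  have := φ.domain_nontrivial
  have hmap : φ.mapMatrix (Matrix.diagonal w) = Matrix.diagonal (φ ∘ w) :=
    Matrix.diagonal_map (map_zero φ)
  rw [← hmap, ← map_neg]
  exact (hR _ (Matrix.not_isUnit_diagonal hi)).isNilCleanElem_or.imp (.map _) (.map _)

lemma IsGWNCRing.two_eq_zero {n : ℕ} (hn : 3 ≤ n) {R K : Type*} [CommRing R] [Field K]
    (hR : IsGWNCRing (Matrix (Fin n) (Fin n) R)) (φ : R →+* K) : (2 : K) = 0 := by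
  classical
  let i₀ : Fin n := ⟨0, by omega⟩
  let i₁ : Fin n := ⟨1, by omega⟩
  let i₂ : Fin n := ⟨2, by omega⟩
  have h01 : i₀ ≠ i₁ := by simp [i₀, i₁]
  let w : Fin n → R := Pi.single i₀ 1 - Pi.single i₁ 1
  have hw : φ ∘ w = Pi.single i₀ 1 - Pi.single i₁ 1 := by
    funext i
    simp [w, Pi.single_apply, apply_ite φ]
  set a : Matrix (Fin n) (Fin n) K := Matrix.diagonal (φ ∘ w) with ha
  have hrank : a.rank ≤ 2 := by
    rw [ha, Matrix.rank_diagonal, Fintype.card_subtype]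
    refine (Finset.card_le_card (t := {i₀, i₁}) fun i hi => ?_).trans Finset.card_le_two
    by_contra hne
    simp only [Finset.mem_insert, Finset.mem_singleton, not_or] at hne
    have hwi : φ (w i) = 0 := (congrFun hw i).trans (by simp [hne.1, hne.2])
    simp [hwi] at hi
  have htr : a.trace = 0 := by
    simp [ha, Matrix.trace_diagonal, hw, Finset.sum_sub_distrib]
  have hnil : ¬ IsNilpotent a := by
    rintro ⟨k, hk⟩
    rw [ha, Matrix.diagonal_pow, Matrix.diagonal_eq_zero] at hk
    have := congrFun hk i₀
    simp [hw, h01] at this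
  obtain h | h := hR.isNilCleanElem_diagonal_or φ (w := w) (i := i₂)
    (by simp [w, i₀, i₁, i₂])
  · exact Matrix.two_eq_zero_of_isNilCleanElem hrank htr hnil h
  · refine Matrix.two_eq_zero_of_isNilCleanElem ?_ ?_ ?_ h
    · rw [← ha, ← neg_one_mul]
      exact (Matrix.rank_mul_le_right _ _).trans hrank
    · rw [← ha, Matrix.trace_neg, htr, neg_zero]
    · rwa [← ha, isNilpotent_neg_iff]

lemma IsGWNCRing.isIdempotentElem_map {n : ℕ} (hn : 3 ≤ n) {R K : Type*} [CommRing R] [Field K]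
    (hR : IsGWNCRing (Matrix (Fin n) (Fin n) R)) (φ : R →+* K) (x : R) :
    IsIdempotentElem (φ x) := by
  have h2 := hR.two_eq_zero hn φ
  have hcast : ∀ r : ℕ, IsIdempotentElem (r : K) := by
    intro r
    rw [IsIdempotentElem]
    obtain ⟨s, hs⟩ := Nat.even_mul_pred_self r
    rcases r with - | r
    · simp
    · rw [Nat.add_sub_cancel] at hs
      have hs' : ((r + 1 : ℕ) : K) * r = s + s := by
        simpa using congrArg (Nat.cast (R := K)) hs
      push_cast at hs' ⊢
      linear_combination hs' + s * h2
  let i₀ : Fin n := ⟨0, by omega⟩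
  let i₁ : Fin n := ⟨1, by omega⟩
  have hw : φ ∘ (Pi.single i₀ x : Fin n → R) = Pi.single i₀ (φ x) := by
    funext i
    simp [Pi.single_apply, apply_ite φ]
  have hneg : -φ x = φ x := by linear_combination -φ x * h2
  obtain ⟨e, q, he, hq, h⟩ | ⟨e, q, he, hq, h⟩ :=
      hR.isNilCleanElem_diagonal_or φ (w := Pi.single i₀ x) (i := i₁) (by simp [i₀, i₁]) <;>
    have := Matrix.trace_eq_rank_of_eq_add he hq h <;>
    simp [hw, Matrix.trace_diagonal, hneg] at this <;>
    exact this ▸ hcast _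

lemma IsGWNCRing.isNilpotent_sq_sub_self {n : ℕ} (hn : 3 ≤ n) {R : Type*} [CommRing R]
    (hR : IsGWNCRing (Matrix (Fin n) (Fin n) R)) (x : R) : IsNilpotent (x ^ 2 - x) := by
  rw [nilpotent_iff_mem_prime]
  intro P hP
  have h := (hR.isIdempotentElem_map hn
    ((algebraMap (R ⧸ P) (FractionRing (R ⧸ P))).comp (Ideal.Quotient.mk P)) x).eq
  rw [← Ideal.Quotient.eq_zero_iff_mem]
  apply IsFractionRing.injective (R ⧸ P) (FractionRing (R ⧸ P))
  rw [map_zero, map_sub, map_sub, sub_eq_zero, pow_two, map_mul, map_mul]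
  exact h

section Endomorphism

variable {K V : Type*} [Field K] [AddCommGroup V] [Module K V]

/-- An endomorphism with an invariant subspace is nil-clean if its two diagonal blocks are. -/
lemma LinearMap.isNilCleanElem_of_invariant (T : End K V) {W W' : Submodule K V}
    (hW : ∀ x ∈ W, T x ∈ W) (hc : IsCompl W W') (h₁ : IsNilCleanElem (R := End K W) (T.restrict hW))
    (h₂ : IsNilCleanElem (R := End K W')
      (W'.projectionOnto W hc.symm ∘ₗ T ∘ₗ W'.subtype)) : IsNilCleanElem T := by
  obtain ⟨e₁, q₁, he₁, ⟨k₁, hk₁⟩, h₁⟩ := h₁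
  obtain ⟨e₂, q₂, he₂, ⟨k₂, hk₂⟩, h₂⟩ := h₂
  set π := W.projectionOnto W' hc
  set π' := W'.projectionOnto W hc.symm
  have hsum : ∀ x, (π x : V) + π' x = x := fun x => W.projection_add_projection_eq_self hc x
  let e : End K V := W.subtype ∘ₗ e₁ ∘ₗ π + W'.subtype ∘ₗ e₂ ∘ₗ π'
  have he : ∀ x, e x = e₁ (π x) + e₂ (π' x) := fun x => rfl
  have hq₁ : ∀ w : W, (T - e) w = q₁ w := by
    intro w
    have hT : T w = q₁ w + e₁ w := congrArg Subtype.val (LinearMap.congr_fun h₁ w)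
    rw [LinearMap.sub_apply, he, hT]
    simp [π, π']
  have hq₂ : ∀ x, π' ((T - e) x) = q₂ (π' x) := by
    intro x
    have hT : π' (T (π' x)) = q₂ (π' x) + e₂ (π' x) := LinearMap.congr_fun h₂ (π' x)
    have hT0 : π' (T (π x)) = 0 :=
      (Submodule.projectionOnto_apply_eq_zero_iff hc.symm).2 (hW _ (π x).2)
    have hTx : π' (T x) = q₂ (π' x) + e₂ (π' x) := by
      rw [← hT, ← zero_add (π' (T (π' x))), ← hT0, ← map_add, ← map_add, hsum]
    rw [LinearMap.sub_apply, map_sub, hTx, he]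
    simp [π']
  have hpow₁ : ∀ (k : ℕ) (w : W), ((T - e) ^ k) w = ((q₁ ^ k) w : W) := by
    intro k
    induction k with
    | zero => simp
    | succ k ih => intro w; rw [pow_succ, pow_succ, Module.End.mul_apply, hq₁, ih]; rfl
  have hpow₂ : ∀ (k : ℕ) (x : V), π' (((T - e) ^ k) x) = (q₂ ^ k) (π' x) := by
    intro k
    induction k with
    | zero => simp
    | succ k ih => intro x; rw [pow_succ, pow_succ, Module.End.mul_apply, ih, hq₂]; rfl
  refine ⟨e, T - e, ?_, ⟨k₁ + k₂, ?_⟩, by simp⟩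
  · refine LinearMap.ext fun x => ?_
    have h₁ : e₁ (e₁ (π x)) = e₁ (π x) := LinearMap.congr_fun he₁ _
    have h₂ : e₂ (e₂ (π' x)) = e₂ (π' x) := LinearMap.congr_fun he₂ _
    rw [Module.End.mul_apply, he (e x), he x]
    simp [π, π', h₁, h₂]
  · refine LinearMap.ext fun x => ?_
    have hmem : ((T - e) ^ k₂) x ∈ W := by
      rw [← Submodule.projectionOnto_apply_eq_zero_iff hc.symm]
      change π' _ = 0
      rw [hpow₂, hk₂]
      rfl
    rw [pow_add, Module.End.mul_apply, hpow₁ k₁ ⟨_, hmem⟩, hk₁]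
    rfl

lemma LinearMap.isNilpotent_of_basis_mem_span {ι : Type*} (b : Basis ι K V) {q : End K V} {v : V}
    (hb : ∀ i, b i ∈ Submodule.span K (Set.range fun j : ℕ => (q ^ j) v)) {n : ℕ}
    (hn : (q ^ n) v = 0) : IsNilpotent q := by
  refine ⟨n, b.ext fun i => ?_⟩
  have hle : Submodule.span K (Set.range fun j : ℕ => (q ^ j) v) ≤ LinearMap.ker (q ^ n) := by
    rw [Submodule.span_le]
    rintro _ ⟨j, rfl⟩
    change (q ^ n) ((q ^ j) v) = 0
    rw [← Module.End.mul_apply, ← pow_add, add_comm, pow_add, Module.End.mul_apply, hn, map_zero]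
  exact hle (hb i)

lemma LinearMap.pow_apply_eq_of_forall_lt {q : End K V} {x : ℕ → V} {m : ℕ}
    (hq : ∀ i < m, q (x i) = x (i + 1)) : ∀ i ≤ m, (q ^ i) (x 0) = x i := by
  intro i
  induction i with
  | zero => simp
  | succ i ih =>
    intro hi
    rw [pow_succ', Module.End.mul_apply, ih (by omega), hq i (by omega)]

lemma LinearMap.apply_eq_zero_of_mem_span_image {e : End K V} {x : ℕ → V} {m : ℕ}
    (he : ∀ i < m, e (x i) = 0) {u : V} (hu : u ∈ Submodule.span K (x '' Set.Iio m)) :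
    e u = 0 := by
  have hle : Submodule.span K (x '' Set.Iio m) ≤ LinearMap.ker e := by
    rw [Submodule.span_le]
    rintro _ ⟨i, hi, rfl⟩
    exact he i hi
  exact hle hu

/-- A cyclic endomorphism of trace one is nil-clean. -/
lemma LinearMap.isNilCleanElem_of_cyclic_of_trace_one {T : End K V} {x : ℕ → V} {m : ℕ}
    (b : Basis (Fin (m + 1)) K V) (hb : ∀ i, b i = x i) (hT : ∀ i, T (x i) = x (i + 1)) {u : V}
    (hu : u ∈ Submodule.span K (x '' Set.Iio m)) (hx : x (m + 1) = u + x m) :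
    IsNilCleanElem T := by
  let e : End K V := b.constr K fun i => if (i : ℕ) < m then 0 else x (m + 1)
  have he : ∀ i (hi : i < m + 1), e (x i) = if i < m then 0 else x (m + 1) := fun i hi => by
    have := b.constr_basis K (fun i => if (i : ℕ) < m then (0 : V) else x (m + 1)) ⟨i, hi⟩
    rwa [hb] at this
  have he₀ : ∀ i < m, e (x i) = 0 := fun i hi => by rw [he i (by omega), if_pos hi]
  have he₁ : e (x m) = x (m + 1) := by rw [he m (by omega), if_neg (by omega)]
  have he₂ : e (x (m + 1)) = x (m + 1) := by
    conv_lhs => rw [hx]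
    rw [map_add, he₁, LinearMap.apply_eq_zero_of_mem_span_image he₀ hu, zero_add]
  have hq : ∀ i < m, (T - e) (x i) = x (i + 1) := fun i hi => by
    rw [LinearMap.sub_apply, he₀ i hi, hT, sub_zero]
  have hpow := LinearMap.pow_apply_eq_of_forall_lt hq
  refine ⟨e, T - e, b.ext fun i => ?_, ?_, by simp⟩
  · rw [Module.End.mul_apply, hb, he i i.2]
    split_ifs
    · exact map_zero e
    · exact he₂
  · refine LinearMap.isNilpotent_of_basis_mem_span b (v := x 0) (n := m + 1) (fun i => ?_) ?_
    · rw [hb, ← hpow i (by omega)]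
      exact Submodule.subset_span ⟨i, rfl⟩
    · rw [pow_succ', Module.End.mul_apply, hpow m le_rfl, LinearMap.sub_apply, he₁, hT, sub_self]

/-- A cyclic endomorphism of trace two of a space of dimension at least three is nil-clean. -/
lemma LinearMap.isNilCleanElem_of_cyclic_of_trace_two {T : End K V} {x : ℕ → V} {m : ℕ}
    (b : Basis (Fin (m + 3)) K V) (hb : ∀ i, b i = x i) (hT : ∀ i, T (x i) = x (i + 1)) {u : V}
    (hu : u ∈ Submodule.span K (x '' Set.Iio (m + 1))) {c : K}
    (hx : x (m + 3) = u + c • x (m + 1) + (2 : K) • x (m + 2)) : IsNilCleanElem T := by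
  let f : ℕ → V := fun i => if i < m + 1 then 0 else
    if i = m + 1 then x (m + 1) + (c + 1) • x m else x (m + 2) + (u + (c + 1) • x m)
  let e : End K V := b.constr K fun i => f i
  have he : ∀ i < m + 3, e (x i) = f i := fun i hi => by
    have := b.constr_basis K (fun i => f i) ⟨i, hi⟩
    rwa [hb] at this
  have he₀ : ∀ i < m + 1, e (x i) = 0 := fun i hi => by
    rw [he i (by omega)]
    exact if_pos hi
  have he₁ : e (x (m + 1)) = x (m + 1) + (c + 1) • x m := by
    rw [he _ (by omega)]
    simp [f]
  have he₂ : e (x (m + 2)) = x (m + 2) + (u + (c + 1) • x m) := by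
    rw [he _ (by omega)]
    simp [f]
  have heu : e u = 0 := LinearMap.apply_eq_zero_of_mem_span_image he₀ hu
  have hq : ∀ i < m + 1, (T - e) (x i) = x (i + 1) := fun i hi => by
    rw [LinearMap.sub_apply, he₀ i hi, hT, sub_zero]
  have hpow := LinearMap.pow_apply_eq_of_forall_lt hq
  have hpow₂ : ((T - e) ^ (m + 2)) (x 0) = x (m + 2) - x (m + 1) - (c + 1) • x m := by
    rw [pow_succ', Module.End.mul_apply, hpow _ le_rfl, LinearMap.sub_apply, he₁, hT]
    abel
  refine ⟨e, T - e, b.ext fun i => ?_, ?_, by simp⟩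
  · rw [Module.End.mul_apply, hb]
    obtain hi | hi | hi : (i : ℕ) < m + 1 ∨ (i : ℕ) = m + 1 ∨ (i : ℕ) = m + 2 := by omega
    · rw [he₀ i hi, map_zero]
    · rw [hi, he₁, map_add, map_smul, he₁, he₀ m (by omega), smul_zero, add_zero]
    · rw [hi, he₂, map_add, map_add, map_smul, he₂, heu, he₀ m (by omega), smul_zero, add_zero,
        add_zero]
  · refine LinearMap.isNilpotent_of_basis_mem_span b (v := x 0) (n := m + 3) (fun i => ?_) ?_
    · have hmem : ∀ i ≤ m + 1,
          x i ∈ Submodule.span K (Set.range fun j : ℕ => ((T - e) ^ j) (x 0)) := fun i hi => by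
        rw [← hpow i hi]
        exact Submodule.subset_span ⟨i, rfl⟩
      rw [hb]
      obtain hi | hi : (i : ℕ) ≤ m + 1 ∨ (i : ℕ) = m + 2 := by omega
      · exact hmem i hi
      · have : x (m + 2) = ((T - e) ^ (m + 2)) (x 0) + x (m + 1) + (c + 1) • x m := by
          rw [hpow₂]
          abel
        rw [hi, this]
        exact add_mem (add_mem (Submodule.subset_span ⟨_, rfl⟩) (hmem _ le_rfl))
          (Submodule.smul_mem _ _ (hmem _ (by omega)))
    · rw [pow_succ', Module.End.mul_apply, hpow₂, map_sub, map_sub, map_smul, hq m (by omega)]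
      simp only [LinearMap.sub_apply, he₁, he₂, hT, hx]
      module

lemma Set.range_fin_val_eq_image_Iio {α : Type*} (x : ℕ → α) (n : ℕ) :
    Set.range (fun i : Fin n => x i) = x '' Set.Iio n := by
  ext y
  constructor
  · rintro ⟨i, rfl⟩
    exact ⟨i, i.2, rfl⟩
  · rintro ⟨i, hi, rfl⟩
    exact ⟨⟨i, hi⟩, rfl⟩

lemma linearIndependent_of_forall_notMem_span_image {x : ℕ → V} {n : ℕ}
    (hx : ∀ k < n, x k ∉ Submodule.span K (x '' Set.Iio k)) :
    LinearIndependent K fun i : Fin n => x i := by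
  induction n with
  | zero => exact linearIndependent_empty_type
  | succ n ih =>
    rw [linearIndependent_finSucc']
    refine ⟨ih fun k hk => hx k (by omega), ?_⟩
    rw [show Fin.init (fun i : Fin (n + 1) => x i) = fun i : Fin n => x i from rfl,
      Set.range_fin_val_eq_image_Iio]
    exact hx n (by omega)

/-- An endomorphism without proper nonzero invariant subspaces is cyclic. -/
lemma LinearMap.exists_basis_of_irreducible [FiniteDimensional K V] {T : End K V}
    (hirr : ∀ W : Submodule K V, (∀ x ∈ W, T x ∈ W) → W = ⊥ ∨ W = ⊤) {v : V} (hv : v ≠ 0) :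
    ∃ (n : ℕ) (b : Basis (Fin n) K V), n ≠ 0 ∧ ∀ i, b i = (T ^ (i : ℕ)) v := by
  classical
  set x : ℕ → V := fun i => (T ^ i) v with hxdef
  have hex : ∃ n, x n ∈ Submodule.span K (x '' Set.Iio n) := by
    by_contra! h
    have := (linearIndependent_of_forall_notMem_span_image (K := K)
      (n := finrank K V + 1) fun k _ => h k).fintype_card_le_finrank
    simp at this
  have hn0 : Nat.find hex ≠ 0 := by
    intro h0
    have := Nat.find_spec hex
    rw [h0] at this
    simp [hxdef, hv] at this
  have hli := linearIndependent_of_forall_notMem_span_image (K := K) (x := x)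
    fun k hk => Nat.find_min hex hk
  have hmem := Nat.find_spec hex
  generalize Nat.find hex = n at hn0 hli hmem
  have htop : Submodule.span K (x '' Set.Iio n) = ⊤ := by
    refine (hirr _ ?_).resolve_left ?_
    · change Submodule.span K (x '' Set.Iio n) ≤
        Submodule.comap T (Submodule.span K (x '' Set.Iio n))
      rw [Submodule.span_le]
      rintro _ ⟨i, hi, rfl⟩
      have hT : T (x i) = x (i + 1) := by simp [hxdef, pow_succ']
      rw [SetLike.mem_coe, Submodule.mem_comap, hT]
      obtain h | h : i + 1 < n ∨ i + 1 = n := by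
        have : i < n := hi
        omega
      · exact Submodule.subset_span ⟨i + 1, h, rfl⟩
      · rwa [h]
    · rw [← Ne, Submodule.ne_bot_iff]
      exact ⟨v, Submodule.subset_span ⟨0, Nat.pos_of_ne_zero hn0, by simp [hxdef]⟩, hv⟩
  exact ⟨n, Basis.mk hli (by rw [Set.range_fin_val_eq_image_Iio, htop]), hn0,
    fun i => by simp [hxdef]⟩

end Endomorphism

/-- A cyclic endomorphism over the field with two elements is nil-clean. -/
lemma LinearMap.isNilCleanElem_of_cyclic {V : Type*} [AddCommGroup V] [Module (ZMod 2) V]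
    {T : End (ZMod 2) V} {v : V} {n : ℕ} (hn : n ≠ 0) (b : Basis (Fin n) (ZMod 2) V)
    (hb : ∀ i, b i = (T ^ (i : ℕ)) v) : IsNilCleanElem T := by
  set x : ℕ → V := fun i => (T ^ i) v with hxdef
  have hb' : ∀ i, b i = x i := hb
  have hT : ∀ i, T (x i) = x (i + 1) := fun i => by simp [hxdef, pow_succ']
  have hbin : ∀ c : ZMod 2, c = 0 ∨ c = 1 := by decide
  have htwo : (2 : ZMod 2) = 0 := rfl
  have hnil : ∀ k, x k = 0 → IsNilCleanElem T := fun k hk =>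
    ⟨0, T, .zero, LinearMap.isNilpotent_of_basis_mem_span b
      (fun i => Submodule.subset_span ⟨i, (hb i).symm⟩) hk, by simp⟩
  have hspan : ∀ {m k : ℕ} (c : Fin m → ZMod 2), m ≤ k →
      ∑ i, c i • x i ∈ Submodule.span (ZMod 2) (x '' Set.Iio k) := fun c hk =>
    Submodule.sum_mem _ fun i _ => Submodule.smul_mem _ _
      (Submodule.subset_span ⟨i, i.2.trans_le hk, rfl⟩)
  have hrep := b.sum_repr (x n)
  simp only [hb'] at hrep
  generalize b.repr (x n) = c at hrep
  obtain ⟨m, rfl⟩ := Nat.exists_eq_succ_of_ne_zero hn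
  rw [Fin.sum_univ_castSucc] at hrep
  simp only [Fin.val_castSucc, Fin.val_last] at hrep
  obtain hc | hc := hbin (c (Fin.last m))
  swap
  · rw [hc, one_smul] at hrep
    exact LinearMap.isNilCleanElem_of_cyclic_of_trace_one b hb' hT (hspan _ le_rfl) hrep.symm
  rw [hc, zero_smul, add_zero] at hrep
  rcases m with - | m
  · exact hnil 1 (by simpa using hrep.symm)
  rw [Fin.sum_univ_castSucc] at hrep
  simp only [Fin.val_castSucc, Fin.val_last] at hrep
  rcases m with - | m
  · obtain hc' | hc' := hbin (c (Fin.last 0).castSucc)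
    · rw [hc'] at hrep
      exact hnil 2 (by simpa using hrep.symm)
    · rw [hc'] at hrep
      have hx₂ : x 2 = x 0 := by simpa using hrep.symm
      have hx₁ : (T - 1) (x 0) = x 1 - x 0 := by simp [hT]
      refine ⟨1, T - 1, .one, LinearMap.isNilpotent_of_basis_mem_span b (v := x 0) (n := 2)
        (fun i => ?_) ?_, by simp⟩
      · have h0 : x 0 ∈ Submodule.span (ZMod 2) (Set.range fun j : ℕ => ((T - 1) ^ j) (x 0)) :=
          Submodule.subset_span ⟨0, by simp⟩
        have h1 : x 1 - x 0 ∈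
            Submodule.span (ZMod 2) (Set.range fun j : ℕ => ((T - 1) ^ j) (x 0)) :=
          Submodule.subset_span ⟨1, by simp [hT]⟩
        rw [hb']
        obtain hi | hi : (i : ℕ) = 0 ∨ (i : ℕ) = 1 := by omega
        · rwa [hi]
        · rw [hi]
          simpa using add_mem h1 h0
      · rw [pow_two, Module.End.mul_apply, hx₁, map_sub, hx₁, LinearMap.sub_apply, hT]
        have : x 2 - x 1 - (x 1 - x 0) = (2 : ZMod 2) • (x 0 - x 1) := by
          rw [hx₂]
          module
        rw [Module.End.one_apply, this, htwo, zero_smul]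
  · refine LinearMap.isNilCleanElem_of_cyclic_of_trace_two b hb' hT
      (hspan (fun i => c i.castSucc.castSucc) le_rfl) (c := c (Fin.last (m + 1)).castSucc) ?_
    rw [htwo, zero_smul, add_zero]
    exact hrep.symm

/-- Every endomorphism of a finite-dimensional space over the field with two elements is
nil-clean. -/
lemma LinearMap.isNilCleanElem_of_zmod_two {V : Type*} [AddCommGroup V] [Module (ZMod 2) V]
    [FiniteDimensional (ZMod 2) V] (T : End (ZMod 2) V) : IsNilCleanElem T := by
  induction h : finrank (ZMod 2) V using Nat.strong_induction_on generalizing V with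
  | _ d ih =>
  by_cases hirr : ∀ W : Submodule (ZMod 2) V, (∀ x ∈ W, T x ∈ W) → W = ⊥ ∨ W = ⊤
  · by_cases hv : ∃ v : V, v ≠ 0
    · obtain ⟨v, hv⟩ := hv
      obtain ⟨n, b, hn, hb⟩ := LinearMap.exists_basis_of_irreducible hirr hv
      exact LinearMap.isNilCleanElem_of_cyclic hn b hb
    · push Not at hv
      exact ⟨0, 0, .zero, .zero, LinearMap.ext fun v => by simp [hv v]⟩
  · push Not at hirr
    obtain ⟨W, hW, hbot, htop⟩ := hirr
    obtain ⟨W', hc⟩ := W.exists_isCompl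
    have hsum := Submodule.finrank_add_eq_of_isCompl hc
    have hlt := Submodule.finrank_lt htop
    have hpos : finrank (ZMod 2) W ≠ 0 := by rwa [Ne, Submodule.finrank_eq_zero]
    exact LinearMap.isNilCleanElem_of_invariant T hW hc (ih _ (by omega) _ rfl)
      (ih _ (by omega) _ rfl)

lemma Matrix.isNilCleanElem_of_zmod_two {ι : Type*} [Fintype ι] [DecidableEq ι]
    (M : Matrix ι ι (ZMod 2)) : IsNilCleanElem M := by
  have h := (LinearMap.isNilCleanElem_of_zmod_two (Matrix.toLinAlgEquiv' M)).map
    (Matrix.toLinAlgEquiv' (R := ZMod 2) (n := ι)).symm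
  rwa [AlgEquiv.symm_apply_apply] at h

theorem matrix_comm_isGWNC_iff_nilClean {R : Type*} [CommRing R] {n : ℕ} (hn : 3 ≤ n) :
    IsGWNCRing (Matrix (Fin n) (Fin n) R) ↔ IsNilCleanRing (Matrix (Fin n) (Fin n) R) := by
  constructor
  · exact fun h => Matrix.isNilCleanElem_of_forall_isNilpotent
      (h.isNilpotent_sq_sub_self hn) Matrix.isNilCleanElem_of_zmod_two
  · intro h a _
    obtain ⟨e, q, he, hq, ha⟩ := h a
    exact ⟨e, q, he, hq, .inl ha⟩
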